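/- Let S be a symmetric 3×3 real matrix that is not a real scalar multiple of G. Then the stabilizer algebra stab(S) = {A ∈ so(G) : Aᵀ·S + S·A = 0} has dimension at most 1. -/

import Mathlib

open Matrix

/-- The Gram matrix of the 3-dimensional Lorentzian inner product in a null triad. -/
noncomputable def Gmat : Matrix (Fin 3) (Fin 3) ℝ := !![0, 0, -1; 0, 1/2, 0; -1, 0, 0]

/-- The stabilizer algebra of a symmetric matrix `S` inside `so(G)`:
matrices `A` with `Aᵀ·G + G·A = 0` and `Aᵀ·S + S·A = 0`. -/
noncomputable def stab (S : Matrix (Fin 3) (Fin 3) ℝ) :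
    Submodule ℝ (Matrix (Fin 3) (Fin 3) ℝ) where
  carrier := {A | Aᵀ * Gmat + Gmat * A = 0 ∧ Aᵀ * S + S * A = 0}
  zero_mem' := by constructor <;> simp
  add_mem' := by
    rintro a b ⟨ha1, ha2⟩ ⟨hb1, hb2⟩
    constructor
    · have h : (a + b)ᵀ * Gmat + Gmat * (a + b)
          = (aᵀ * Gmat + Gmat * a) + (bᵀ * Gmat + Gmat * b) := by
        rw [Matrix.transpose_add]; noncomm_ring
      rw [h, ha1, hb1, add_zero]
    · have h : (a + b)ᵀ * S + S * (a + b)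
          = (aᵀ * S + S * a) + (bᵀ * S + S * b) := by
        rw [Matrix.transpose_add]; noncomm_ring
      rw [h, ha2, hb2, add_zero]
  smul_mem' := by
    rintro c a ⟨ha1, ha2⟩
    constructor
    · have h : (c • a)ᵀ * Gmat + Gmat * (c • a) = c • (aᵀ * Gmat + Gmat * a) := by
        rw [Matrix.transpose_smul, Matrix.smul_mul, Matrix.mul_smul, smul_add]
      rw [h, ha1, smul_zero]
    · have h : (c • a)ᵀ * S + S * (c • a) = c • (aᵀ * S + S * a) := by
        rw [Matrix.transpose_smul, Matrix.smul_mul, Matrix.mul_smul, smul_add]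
      rw [h, ha2, smul_zero]

/-- The entries of a matrix in `so(G)`, together with the equations expressing that it
stabilizes the symmetric matrix `S`. -/
lemma stab_entries {S A : Matrix (Fin 3) (Fin 3) ℝ} (hS : S.IsSymm) (hA : A ∈ stab S) :
    ∃ p q r : ℝ, A = !![q, r, 0; -2 * p, 0, 2 * r; 0, -p, -q] ∧
      S 0 0 * q = 2 * S 0 1 * p ∧ S 0 1 * r = S 1 2 * p ∧ S 2 2 * q = 2 * S 1 2 * r ∧
      S 0 0 * r + S 0 1 * q = (S 0 2 + 2 * S 1 1) * p ∧
      (S 0 2 + 2 * S 1 1) * r = S 1 2 * q + S 2 2 * p := by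
  obtain ⟨hG, hSA⟩ := hA
  have h10 := hS.apply 0 1
  have h20 := hS.apply 0 2
  have h21 := hS.apply 1 2
  have g := fun i j => congrFun (congrFun hG i) j
  have s := fun i j => congrFun (congrFun hSA i) j
  simp only [Gmat, Matrix.add_apply, Matrix.mul_apply, Fin.sum_univ_three,
    Matrix.transpose_apply, Matrix.zero_apply] at g s
  have g00 := g 0 0
  have g01 := g 0 1
  have g02 := g 0 2
  have g11 := g 1 1
  have g12 := g 1 2
  have g22 := g 2 2
  simp at g00 g01 g02 g11 g12 g22
  have e20 : A 2 0 = 0 := by linarith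
  have e02 : A 0 2 = 0 := by linarith
  have e11 : A 1 1 = 0 := by linarith
  have e10 : A 1 0 = 2 * A 2 1 := by linarith
  have e12 : A 1 2 = 2 * A 0 1 := by linarith
  have e22 : A 2 2 = -A 0 0 := by linarith
  have s00 := s 0 0
  have s01 := s 0 1
  have s11 := s 1 1
  have s12 := s 1 2
  have s22 := s 2 2
  simp only [h10, h20, h21, e20, e02, e11, e10, e12, e22] at s00 s01 s11 s12 s22
  refine ⟨-A 2 1, A 0 0, A 0 1, ?_, by linarith, by linarith, by linarith, by linarith,
    by linarith⟩
  ext i j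
  fin_cases i <;> fin_cases j <;> simp [e20, e02, e11, e10, e12, e22]

/-- If `S` is not a multiple of `G`, an element of the stabilizer algebra is determined by
a single suitable entry. -/
lemma exists_entry_determines_stab {S : Matrix (Fin 3) (Fin 3) ℝ} (hS : S.IsSymm)
    (hnot : ¬∃ c : ℝ, S = c • Gmat) :
    ∃ i j : Fin 3, ∀ A ∈ stab S, A i j = 0 → A = 0 := by
  have key (i j : Fin 3) (h : ∀ p q r : ℝ,
      S 0 0 * q = 2 * S 0 1 * p → S 0 1 * r = S 1 2 * p → S 2 2 * q = 2 * S 1 2 * r →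
      S 0 0 * r + S 0 1 * q = (S 0 2 + 2 * S 1 1) * p →
      (S 0 2 + 2 * S 1 1) * r = S 1 2 * q + S 2 2 * p →
      !![q, r, 0; -2 * p, 0, 2 * r; 0, -p, -q] i j = 0 → p = 0 ∧ q = 0 ∧ r = 0) :
      ∃ i j : Fin 3, ∀ A ∈ stab S, A i j = 0 → A = 0 := by
    refine ⟨i, j, fun A hA hij => ?_⟩
    obtain ⟨p, q, r, rfl, h1, h2, h3, h4, h5⟩ := stab_entries hS hA
    obtain ⟨rfl, rfl, rfl⟩ := h p q r h1 h2 h3 h4 h5 hij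
    ext i j
    fin_cases i <;> fin_cases j <;> simp
  by_cases hb : S 0 1 = 0
  swap
  · refine key 2 1 fun p q r h1 h2 h3 h4 h5 h => ?_
    have hp : p = 0 := by simpa using h
    have hr : r = 0 := by simpa [hp, hb] using h2
    have hq : q = 0 := by simpa [hp, hr, hb] using h4
    exact ⟨hp, hq, hr⟩
  by_cases he : S 1 2 = 0
  swap
  · refine key 0 1 fun p q r h1 h2 h3 h4 h5 h => ?_
    have hr : r = 0 := by simpa using h
    have hp : p = 0 := by simpa [hr, he] using h2
    have hq : q = 0 := by simpa [hp, hr, he] using h5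
    exact ⟨hp, hq, hr⟩
  by_cases ha : S 0 0 = 0
  swap
  · refine key 2 1 fun p q r h1 h2 h3 h4 h5 h => ?_
    have hp : p = 0 := by simpa using h
    have hq : q = 0 := by simpa [hp, ha] using h1
    have hr : r = 0 := by simpa [hp, hb, ha] using h4
    exact ⟨hp, hq, hr⟩
  by_cases hf : S 2 2 = 0
  swap
  · refine key 0 1 fun p q r h1 h2 h3 h4 h5 h => ?_
    have hr : r = 0 := by simpa using h
    have hq : q = 0 := by simpa [hr, hf] using h3
    have hp : p = 0 := by simpa [hr, he, hf] using h5
    exact ⟨hp, hq, hr⟩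
  by_cases ht : S 0 2 + 2 * S 1 1 = 0
  swap
  · refine key 0 0 fun p q r h1 h2 h3 h4 h5 h => ?_
    have hq : q = 0 := by simpa using h
    have hp : p = 0 := by simpa [ha, hb, ht] using h4
    have hr : r = 0 := by simpa [he, hf, ht] using h5
    exact ⟨hp, hq, hr⟩
  refine absurd ⟨2 * S 1 1, ?_⟩ hnot
  have hc : S 0 2 = -(2 * S 1 1) := by linarith
  have h10 := hS.apply 0 1
  have h20 := hS.apply 0 2
  have h21 := hS.apply 1 2
  ext i j
  fin_cases i <;> fin_cases j <;> simp [Gmat, h10, h20, h21, hb, he, ha, hf, hc]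
  ring

/-- If a symmetric `3 × 3` real matrix `S` (the Ricci tensor) is not a real scalar
multiple of the Lorentzian Gram matrix `G` (i.e. its trace-free part is nonzero,
Petrov type ≠ O), then its stabilizer algebra in `so(G)` has dimension at most `1`. -/
theorem stab_dim_le_one (S : Matrix (Fin 3) (Fin 3) ℝ) (hS : S.IsSymm)
    (hnot : ¬∃ c : ℝ, S = c • Gmat) :
    Module.finrank ℝ (stab S) ≤ 1 := by
  obtain ⟨i, j, hij⟩ := exists_entry_determines_stab hS hnot
  let φ : stab S →ₗ[ℝ] ℝ := (Matrix.entryLinearMap ℝ ℝ i j).comp (stab S).subtype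
  have hφ : Function.Injective φ := by
    rw [injective_iff_map_eq_zero]
    exact fun A hA => Subtype.ext (hij A A.2 hA)
  simpa using LinearMap.finrank_le_finrank_of_injective hφ
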